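/- Let ψ : ℝ² → ℝ be a C² scalar function compactly supported in 𝔻. Then for all x ∈ ℝ²: T₁¹(∇⊥ψ)(x) = ∫₀^∞ ψ(x + t·u(x)) dt − ∫₀^∞ ψ(x + t·v(x)) dt, i.e. the first moment transverse V-line transform of the field ∇⊥ψ equals the weighted V-line transform V₋₁ψ of ψ with weight α = −1. -/

import Mathlib

open MeasureTheory

noncomputable section

/-- Euclidean dot product on `ℝ × ℝ`. -/
def dot (a b : ℝ × ℝ) : ℝ := a.1 * b.1 + a.2 * b.2

/-- Rotation by `π/2`: `w⊥ = (−w₂, w₁)`. -/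
def perp (w : ℝ × ℝ) : ℝ × ℝ := (-w.2, w.1)

/-- The open unit disc in `ℝ²`. -/
def disc : Set (ℝ × ℝ) := {p : ℝ × ℝ | p.1 ^ 2 + p.2 ^ 2 < 1}

/-- Perpendicular gradient `∇⊥ψ = (−∂ψ/∂x₂, ∂ψ/∂x₁)`. -/
def pgrad (ψ : ℝ × ℝ → ℝ) (x : ℝ × ℝ) : ℝ × ℝ :=
  (-(fderiv ℝ ψ x (0, 1)), fderiv ℝ ψ x (1, 0))

/-- First moment transverse V-line transform with weight `α = 1`. -/
def T1m (u v : ℝ × ℝ → ℝ × ℝ) (f : ℝ × ℝ → ℝ × ℝ) (x : ℝ × ℝ) : ℝ :=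
  (- ∫ t in Set.Ioi (0 : ℝ), t * dot (perp (u x)) (f (x + t • u x))) +
    ∫ t in Set.Ioi (0 : ℝ), t * dot (perp (v x)) (f (x + t • v x))

theorem line_ibp (ψ : ℝ × ℝ → ℝ) (hψ : ContDiff ℝ 2 ψ) (hcs : HasCompactSupport ψ)
    (x w : ℝ × ℝ) (hw : dot w w = 1) :
    ∫ t in Set.Ioi (0 : ℝ), t * dot (perp w) (pgrad ψ (x + t • w)) =
      - ∫ t in Set.Ioi (0 : ℝ), ψ (x + t • w) := by
  have hw0 : w ≠ 0 := by
    rintro rfl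
    simp [dot] at hw
  have hemb : Topology.IsClosedEmbedding (fun t : ℝ => x + t • w) :=
    (Homeomorph.addLeft x).isClosedEmbedding.comp (isClosedEmbedding_smul_left hw0)
  have hgc : HasCompactSupport (fun t : ℝ => ψ (x + t • w)) :=
    hcs.comp_isClosedEmbedding hemb
  have hline : ContDiff ℝ 2 (fun t : ℝ => x + t • w) := by fun_prop
  have hg : ContDiff ℝ 2 (fun t : ℝ => ψ (x + t • w)) := hψ.comp hline
  have hg1 : ContDiff ℝ 1 (fun t : ℝ => ψ (x + t • w)) := hg.of_le (by norm_num)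
  have hdir : ∀ t : ℝ, dot (perp w) (pgrad ψ (x + t • w)) = fderiv ℝ ψ (x + t • w) w := by
    intro t
    have h : w = w.1 • ((1 : ℝ), (0 : ℝ)) + w.2 • ((0 : ℝ), (1 : ℝ)) := by
      ext <;> simp
    conv_rhs => rw [h]
    rw [map_add, map_smul, map_smul, ← h]
    simp only [dot, perp, pgrad, smul_eq_mul]
    ring
  have hder : ∀ t : ℝ, HasDerivAt (fun t : ℝ => ψ (x + t • w))
      (fderiv ℝ ψ (x + t • w) w) t := by
    intro t
    have h1 : HasDerivAt (fun t : ℝ => x + t • w) w t := by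
      simpa using ((hasDerivAt_id t).smul_const w).const_add x
    exact ((hψ.differentiable (by norm_num)) _).hasFDerivAt.comp_hasDerivAt t h1
  have hderiv : deriv (fun t : ℝ => ψ (x + t • w)) =
      fun t => fderiv ℝ ψ (x + t • w) w := funext fun t => (hder t).deriv
  have hF : ContDiff ℝ 1 (fun t : ℝ => t * ψ (x + t • w)) := contDiff_id.mul hg1
  have hFc : HasCompactSupport (fun t : ℝ => t * ψ (x + t • w)) := hgc.mul_left
  have key := hFc.integral_Ioi_deriv_eq hF 0
  have hFd : ∀ t : ℝ, deriv (fun t : ℝ => t * ψ (x + t • w)) t =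
      ψ (x + t • w) + t * fderiv ℝ ψ (x + t • w) w := by
    intro t
    have h := ((hasDerivAt_id' t).mul (hder t)).deriv
    rw [one_mul] at h
    exact h
  have hi1 : Integrable (fun t : ℝ => ψ (x + t • w)) :=
    hg.continuous.integrable_of_hasCompactSupport hgc
  have hdc : Continuous (fun t : ℝ => fderiv ℝ ψ (x + t • w) w) := by
    rw [← hderiv]
    exact hg1.continuous_deriv le_rfl
  have hds : HasCompactSupport (fun t : ℝ => fderiv ℝ ψ (x + t • w) w) := by
    rw [← hderiv]
    exact hgc.deriv
  have hi2 : Integrable (fun t : ℝ => t * fderiv ℝ ψ (x + t • w) w) :=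
    (continuous_id.mul hdc).integrable_of_hasCompactSupport hds.mul_left
  simp only [hFd] at key
  rw [integral_add hi1.integrableOn hi2.integrableOn] at key
  simp only [hdir]
  simp only [zero_mul, neg_zero] at key
  linarith

theorem stmt11
    (u v : ℝ × ℝ → ℝ × ℝ) (hu : ContDiff ℝ 1 u) (hv : ContDiff ℝ 1 v)
    (hunitu : ∀ x, dot (u x) (u x) = 1) (hunitv : ∀ x, dot (v x) (v x) = 1)
    (hlineu : ∀ (x : ℝ × ℝ) (t : ℝ), 0 ≤ t → u (x + t • u x) = u x)
    (hlinev : ∀ (x : ℝ × ℝ) (t : ℝ), 0 ≤ t → v (x + t • v x) = v x)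
    (hind : ∀ x, LinearIndependent ℝ ![u x, v x])
    (ψ : ℝ × ℝ → ℝ) (hψ : ContDiff ℝ 2 ψ)
    (hcs : HasCompactSupport ψ) (hsupp : tsupport ψ ⊆ disc) :
    ∀ x, T1m u v (pgrad ψ) x =
      (∫ t in Set.Ioi (0 : ℝ), ψ (x + t • u x)) -
        ∫ t in Set.Ioi (0 : ℝ), ψ (x + t • v x) := by
  intro x
  unfold T1m
  rw [line_ibp ψ hψ hcs x (u x) (hunitu x), line_ibp ψ hψ hcs x (v x) (hunitv x)]
  ring
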